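/- Let θ, θ̃ ∈ ℓ²(ℤ;ℂ) and let g be any Borel probability measure on [0,1]. Then the Hellinger distance between the mixture measures on ℂ^ℤ satisfies d_H(P_{θ,g}, P_{θ̃,g}) ≤ 2^{1/4} ‖θ − θ̃‖^{1/2}, where ‖θ − θ̃‖ is the ℓ²(ℤ) norm of θ − θ̃. -/

import Mathlib

open MeasureTheory Real Set

/-- the standard complex Gaussian probability measure N_ℂ(μ,1) on ℂ,
with Lebesgue density z ↦ π⁻¹ e^{−|z−μ|²} -/
noncomputable def gaussC (μ : ℂ) : Measure ℂ :=
  volume.withDensity (fun z => ENNReal.ofReal (Real.pi⁻¹ * Real.exp (-‖z - μ‖ ^ 2)))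

/-- the rotated sequence (θ•φ)_k = θ_k e^{−2iπkφ} -/
noncomputable def rotZ (θ : ℤ → ℂ) (φ : ℝ) : ℤ → ℂ :=
  fun k => θ k * Complex.exp (-Complex.I * (2 * Real.pi * (k : ℝ) * φ))

/-- `P` is the product measure ⊗_{k∈ℤ} N_ℂ(θ_k e^{−2iπkφ}, 1) on ℂ^ℤ (product σ-algebra),
characterized as the projective limit of its finite-dimensional Gaussian product marginals. -/
def IsGaussProduct (θ : ℤ → ℂ) (φ : ℝ) (P : Measure (ℤ → ℂ)) : Prop :=
  IsProbabilityMeasure P ∧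
    IsProjectiveLimit P (fun J : Finset ℤ => Measure.pi (fun k : J => gaussC (rotZ θ φ k)))

/-- g is a Borel probability measure on [0,1] (encoded as a measure on ℝ carried by [0,1]) -/
def IsProbOn01 (g : MeasureTheory.Measure ℝ) : Prop :=
  MeasureTheory.IsProbabilityMeasure g ∧ g (Set.Icc 0 1) = 1

/-- `P` is the mixture P_{θ,g}(A) = ∫₀¹ (⊗_{k∈ℤ} N_ℂ(θ_k e^{−2iπkφ},1))(A) dg(φ) on ℂ^ℤ. -/
def IsMixtureLaw (θ : ℤ → ℂ) (g : Measure ℝ) (P : Measure (ℤ → ℂ)) : Prop :=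
  ∃ Pp : ℝ → Measure (ℤ → ℂ), (∀ φ : ℝ, IsGaussProduct θ φ (Pp φ)) ∧
    ∀ A : Set (ℤ → ℂ), MeasurableSet A → P A = ∫⁻ φ, Pp φ A ∂g

/-- Hellinger distance between two measures (computed through densities with respect to
the dominating measure P + Q; it does not depend on this choice). -/
noncomputable def dH {X : Type*} [MeasurableSpace X] (P Q : Measure X) : ℝ :=
  Real.sqrt (∫ x, (Real.sqrt ((P.rnDeriv (P + Q) x).toReal)
      - Real.sqrt ((Q.rnDeriv (P + Q) x).toReal)) ^ 2 ∂(P + Q))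

/-- total variation distance between two measures: sup over measurable sets A of |P(A) − Q(A)| -/
noncomputable def dTV {X : Type*} [MeasurableSpace X] (P Q : Measure X) : ℝ :=
  ⨆ (A : Set X) (_ : MeasurableSet A), |(P A).toReal - (Q A).toReal|

/-- the ℓ²(ℤ) norm of a sequence -/
noncomputable def l2norm (θ : ℤ → ℂ) : ℝ := Real.sqrt (∑' k : ℤ, ‖θ k‖ ^ 2)

/-- the Lebesgue density of `gaussC μ` -/
noncomputable def gaussDensity (μ z : ℂ) : ℝ := Real.pi⁻¹ * Real.exp (-‖z - μ‖ ^ 2)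

lemma gaussDensity_pos (μ z : ℂ) : 0 < gaussDensity μ z := by
  unfold gaussDensity; positivity

lemma integral_gaussDensity (μ : ℂ) : ∫ z, gaussDensity μ z = 1 := by
  have h := GaussianFourier.integral_rexp_neg_mul_sq_norm (V := ℂ) (b := 1) one_pos
  have h2 := integral_sub_right_eq_self (μ := volume) (fun z : ℂ => Real.exp (-1 * ‖z‖ ^ 2)) μ
  rw [h] at h2
  simp only [Complex.finrank_real_complex, div_one, neg_mul, one_mul] at h2
  unfold gaussDensity
  rw [integral_const_mul, h2]
  norm_num

lemma integrable_gaussDensity (μ : ℂ) : Integrable (gaussDensity μ) :=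
  .of_integral_ne_zero (by rw [integral_gaussDensity]; exact one_ne_zero)

lemma measurable_gaussDensity (μ : ℂ) : Measurable (gaussDensity μ) := by
  unfold gaussDensity; fun_prop

lemma gaussDensity_mul (μ ν z : ℂ) :
    gaussDensity μ z * gaussDensity ν z
      = (gaussDensity ((μ + ν) / 2) z * Real.exp (-‖μ - ν‖ ^ 2 / 4)) ^ 2 := by
  have key : ‖z - μ‖ ^ 2 + ‖z - ν‖ ^ 2
      = 2 * ‖z - (μ + ν) / 2‖ ^ 2 + ‖μ - ν‖ ^ 2 / 2 := by
    simp only [← Complex.normSq_eq_norm_sq, Complex.normSq_apply]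
    simp
    ring
  unfold gaussDensity
  have e1 : Real.exp (-‖z - μ‖ ^ 2) * Real.exp (-‖z - ν‖ ^ 2)
      = (Real.exp (-‖z - (μ + ν) / 2‖ ^ 2) * Real.exp (-‖μ - ν‖ ^ 2 / 4)) ^ 2 := by
    rw [← Real.exp_add, ← Real.exp_add, ← Real.exp_nat_mul]
    congr 1
    push_cast
    linarith
  linear_combination (Real.pi⁻¹) ^ 2 * e1

instance isProbabilityMeasure_gaussC (μ : ℂ) : IsProbabilityMeasure (gaussC μ) where
  measure_univ := by
    change (volume.withDensity fun z => ENNReal.ofReal (gaussDensity μ z)) univ = 1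
    rw [withDensity_apply _ MeasurableSet.univ, Measure.restrict_univ,
      ← ofReal_integral_eq_lintegral_ofReal (integrable_gaussDensity μ)
        (ae_of_all _ fun z => (gaussDensity_pos μ z).le), integral_gaussDensity, ENNReal.ofReal_one]

lemma pi_gaussC_eq_withDensity {ι : Type*} [Fintype ι] (μ : ι → ℂ) :
    Measure.pi (fun i => gaussC (μ i))
      = (Measure.pi fun _ : ι => (volume : Measure ℂ)).withDensity
        (fun z => ENNReal.ofReal (∏ i, gaussDensity (μ i) (z i))) := by
  refine Measure.pi_eq fun s hs => ?_
  rw [withDensity_apply _ (MeasurableSet.univ_pi hs), Measure.restrict_pi_pi,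
    ← ofReal_integral_eq_lintegral_ofReal
      (Integrable.fintype_prod fun i => (integrable_gaussDensity (μ i)).restrict)
      (ae_of_all _ fun z => Finset.prod_nonneg fun i _ => (gaussDensity_pos _ _).le),
    integral_fintype_prod_eq_prod,
    ENNReal.ofReal_prod_of_nonneg fun i _ =>
      integral_nonneg fun z => (gaussDensity_pos _ _).le]
  refine Finset.prod_congr rfl fun i _ => ?_
  rw [ofReal_integral_eq_lintegral_ofReal (integrable_gaussDensity (μ i)).restrict
    (ae_of_all _ fun z => (gaussDensity_pos _ _).le), gaussC, withDensity_apply _ (hs i)]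
  rfl

/-- The Le Cam inequality: the difference of two probabilities is bounded in terms of the
Hellinger affinity `ρ` of the underlying densities. -/
lemma withDensity_le_add_of_affinity {X : Type*} [MeasurableSpace X] {lam : Measure X}
    {f g h : X → ℝ} (hf : Integrable f lam) (hg : Integrable g lam) (hh : Integrable h lam)
    (f0 : ∀ x, 0 ≤ f x) (g0 : ∀ x, 0 ≤ g x) (h0 : ∀ x, 0 ≤ h x)
    (hfg : ∀ x, f x * g x = h x ^ 2) (f1 : ∫ x, f x ∂lam = 1) (g1 : ∫ x, g x ∂lam = 1)
    {ρ : ℝ} (hρ : ∫ x, h x ∂lam = ρ) {A : Set X} (hA : MeasurableSet A) :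
    (lam.withDensity fun x => ENNReal.ofReal (f x)) A
      ≤ (lam.withDensity fun x => ENNReal.ofReal (g x)) A
        + ENNReal.ofReal (Real.sqrt (1 - ρ ^ 2)) := by
  set D := ∫ x, |f x - g x| ∂lam
  have hpt : ∀ t x, 2 * t * |f x - g x|
      ≤ t ^ 2 * (f x + g x - 2 * h x) + (f x + g x + 2 * h x) := by
    intro t x
    have hs : h x = √(f x) * √(g x) := by
      rw [← Real.sqrt_mul (f0 x), hfg, Real.sqrt_sq (h0 x)]
    have ef := Real.sq_sqrt (f0 x)
    have eg := Real.sq_sqrt (g0 x)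
    set u := √(f x)
    set v := √(g x)
    rw [hs, ← ef, ← eg]
    have huv : 0 ≤ u + v := add_nonneg (Real.sqrt_nonneg _) (Real.sqrt_nonneg _)
    have : |u ^ 2 - v ^ 2| = |u - v| * (u + v) := by
      rw [show u ^ 2 - v ^ 2 = (u - v) * (u + v) by ring, abs_mul, abs_of_nonneg huv]
    rw [this]
    nlinarith [sq_nonneg (t * |u - v| - (u + v)), sq_abs (u - v)]
  have hDt : ∀ t, 2 * t * D ≤ t ^ 2 * (2 - 2 * ρ) + (2 + 2 * ρ) := by
    intro t
    have := integral_mono ((hf.sub hg).abs.const_mul (2 * t))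
      ((((hf.add hg).sub (hh.const_mul 2)).const_mul (t ^ 2)).add
        ((hf.add hg).add (hh.const_mul 2))) (hpt t)
    simp only [Pi.add_apply, Pi.sub_apply] at this
    rw [integral_const_mul, integral_add (by fun_prop) (by fun_prop), integral_const_mul,
      integral_sub (by fun_prop) (by fun_prop), integral_add (by fun_prop) (by fun_prop),
      integral_add (by fun_prop) (by fun_prop), integral_add hf hg, integral_const_mul, f1, g1,
      hρ] at this
    linarith
  have hdisc := discrim_le_zero (a := 2 - 2 * ρ) (b := -2 * D) (c := 2 + 2 * ρ)
    (fun t => by nlinarith [hDt t])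
  rw [discrim] at hdisc
  have hbound : D / 2 ≤ √(1 - ρ ^ 2) := Real.le_sqrt_of_sq_le (by nlinarith)
  have hcompl : ∫ x in A, (f x - g x) ∂lam + ∫ x in Aᶜ, (f x - g x) ∂lam = 0 := by
    refine (integral_add_compl hA (hf.sub hg)).trans ?_
    rw [integral_sub' hf hg, f1, g1, sub_self]
  have habs : ∫ x in A, |f x - g x| ∂lam + ∫ x in Aᶜ, |f x - g x| ∂lam = D :=
    integral_add_compl hA (hf.sub hg).abs
  have hA1 : ∫ x in A, (f x - g x) ∂lam ≤ ∫ x in A, |f x - g x| ∂lam :=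
    (le_abs_self _).trans abs_integral_le_integral_abs
  have hA2 : -∫ x in Aᶜ, (f x - g x) ∂lam ≤ ∫ x in Aᶜ, |f x - g x| ∂lam :=
    (neg_le_abs _).trans abs_integral_le_integral_abs
  rw [integral_sub hf.restrict hg.restrict] at hA1 hcompl
  rw [withDensity_apply _ hA, withDensity_apply _ hA,
    ← ofReal_integral_eq_lintegral_ofReal hf.restrict (ae_of_all _ f0),
    ← ofReal_integral_eq_lintegral_ofReal hg.restrict (ae_of_all _ g0),
    ← ENNReal.ofReal_add (integral_nonneg g0) (Real.sqrt_nonneg _)]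
  exact ENNReal.ofReal_le_ofReal (by linarith)

lemma pi_gaussC_le_add {ι : Type*} [Fintype ι] (μ ν : ι → ℂ) {A : Set (ι → ℂ)}
    (hA : MeasurableSet A) :
    Measure.pi (fun i => gaussC (μ i)) A ≤ Measure.pi (fun i => gaussC (ν i)) A
      + ENNReal.ofReal (√((∑ i, ‖μ i - ν i‖ ^ 2) / 2)) := by
  have hintegrable : ∀ μ : ι → ℂ, Integrable (fun z : ι → ℂ => ∏ i, gaussDensity (μ i) (z i))
      (Measure.pi fun _ => volume) :=
    fun μ => Integrable.fintype_prod fun i => integrable_gaussDensity (μ i)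
  have hone : ∀ μ : ι → ℂ, ∫ z : ι → ℂ, ∏ i, gaussDensity (μ i) (z i)
      ∂(Measure.pi fun _ => volume) = 1 := fun μ => by
    rw [integral_fintype_prod_eq_prod]; simp [integral_gaussDensity]
  have hnn : ∀ (μ : ι → ℂ) (z : ι → ℂ), 0 ≤ ∏ i, gaussDensity (μ i) (z i) :=
    fun μ z => Finset.prod_nonneg fun i _ => (gaussDensity_pos _ _).le
  set S := ∑ i, ‖μ i - ν i‖ ^ 2
  have hexp : Real.exp (-S / 4) = ∏ i, Real.exp (-‖μ i - ν i‖ ^ 2 / 4) := by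
    rw [← Real.exp_sum, ← Finset.sum_div, Finset.sum_neg_distrib]
  rw [pi_gaussC_eq_withDensity, pi_gaussC_eq_withDensity]
  refine (withDensity_le_add_of_affinity (hintegrable μ) (hintegrable ν)
    ((hintegrable fun i => (μ i + ν i) / 2).mul_const (Real.exp (-S / 4))) (hnn μ) (hnn ν)
    (fun z => mul_nonneg (hnn _ z) (Real.exp_pos _).le) (fun z => ?_) (hone μ) (hone ν)
    (ρ := Real.exp (-S / 4)) ?_ hA).trans ?_
  · rw [hexp, ← Finset.prod_mul_distrib, ← Finset.prod_mul_distrib, ← Finset.prod_pow]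
    exact Finset.prod_congr rfl fun i _ => gaussDensity_mul _ _ _
  · rw [integral_mul_const, hone, one_mul]
  · gcongr
    have h1 : Real.exp (-S / 4) ^ 2 = Real.exp (-S / 2) := by
      rw [← Real.exp_nat_mul]; congr 1; push_cast; ring
    rw [h1]
    linarith [Real.add_one_le_exp (-S / 2)]

lemma norm_rotZ_sub (θ θt : ℤ → ℂ) (φ : ℝ) (k : ℤ) :
    ‖rotZ θ φ k - rotZ θt φ k‖ = ‖θ k - θt k‖ := by
  unfold rotZ
  rw [← sub_mul, norm_mul, show -Complex.I * (2 * Real.pi * ((k : ℝ) : ℂ) * φ)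
    = ((-(2 * Real.pi * k * φ) : ℝ) : ℂ) * Complex.I by push_cast; ring,
    Complex.norm_exp_ofReal_mul_I, mul_one]

/-- A uniform bound on the differences of two finite measures extends from measurable cylinders
to all measurable sets. -/
lemma le_add_of_forall_measurableCylinders {ι : Type*} {α : ι → Type*}
    [∀ i, MeasurableSpace (α i)] {P Q : Measure (∀ i, α i)} [IsFiniteMeasure P]
    [IsFiniteMeasure Q] {c : ENNReal} (h : ∀ B ∈ measurableCylinders α, P B ≤ Q B + c)
    {A : Set (∀ i, α i)} (hA : MeasurableSet A) : P A ≤ Q A + c := by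
  refine ENNReal.le_of_forall_pos_le_add fun ε hε _ => ?_
  obtain ⟨B, hB, hAB⟩ := (Measure.MeasureDense.of_generateFrom_isSetAlgebra_finite (P + Q)
    isSetAlgebra_measurableCylinders generateFrom_measurableCylinders.symm).approx A hA
    (measure_ne_top _ _) ε (by exact_mod_cast hε)
  rw [Measure.add_apply, ENNReal.ofReal_coe_nnreal] at hAB
  calc P A ≤ P B + P (symmDiff A B) := by
        refine (measure_mono fun x hx => ?_).trans (measure_union_le _ _)
        by_cases hxB : x ∈ B
        · exact Or.inl hxB
        · exact Or.inr (Or.inl ⟨hx, hxB⟩)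
    _ ≤ (Q B + c) + P (symmDiff A B) := by gcongr; exact h B hB
    _ ≤ ((Q A + Q (symmDiff A B)) + c) + P (symmDiff A B) := by
        gcongr
        refine (measure_mono fun x hx => ?_).trans (measure_union_le _ _)
        by_cases hxA : x ∈ A
        · exact Or.inl hxA
        · exact Or.inr (Or.inr ⟨hx, hxA⟩)
    _ = Q A + c + (P (symmDiff A B) + Q (symmDiff A B)) := by ring
    _ ≤ Q A + c + ε := by gcongr

lemma IsGaussProduct.le_add {θ θt : ℤ → ℂ} {φ : ℝ} {P Q : Measure (ℤ → ℂ)}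
    (hP : IsGaussProduct θ φ P) (hQ : IsGaussProduct θt φ Q)
    (hs : Summable fun k => ‖θ k - θt k‖ ^ 2) {A : Set (ℤ → ℂ)} (hA : MeasurableSet A) :
    P A ≤ Q A + ENNReal.ofReal (√((∑' k, ‖θ k - θt k‖ ^ 2) / 2)) := by
  have := hP.1
  have := hQ.1
  refine le_add_of_forall_measurableCylinders (fun B hB => ?_) hA
  obtain ⟨J, S, hS, rfl⟩ := (mem_measurableCylinders _).mp hB
  rw [hP.2.measure_cylinder _ hS, hQ.2.measure_cylinder _ hS]
  refine (pi_gaussC_le_add _ (fun k : J => rotZ θt φ k) hS).trans ?_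
  gcongr
  simp_rw [norm_rotZ_sub]
  rw [Finset.sum_coe_sort J fun k => ‖θ k - θt k‖ ^ 2]
  exact hs.sum_le_tsum J fun k _ => by positivity

lemma IsMixtureLaw.le_add {θ θt : ℤ → ℂ} {g : Measure ℝ} [IsProbabilityMeasure g]
    {P Q : Measure (ℤ → ℂ)} (hP : IsMixtureLaw θ g P) (hQ : IsMixtureLaw θt g Q)
    (hs : Summable fun k => ‖θ k - θt k‖ ^ 2) {A : Set (ℤ → ℂ)} (hA : MeasurableSet A) :
    P A ≤ Q A + ENNReal.ofReal (√((∑' k, ‖θ k - θt k‖ ^ 2) / 2)) := by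
  obtain ⟨Pp, hPp, hP⟩ := hP
  obtain ⟨Qp, hQp, hQ⟩ := hQ
  rw [hP A hA, hQ A hA]
  refine (lintegral_mono fun φ => (hPp φ).le_add (hQp φ) hs hA).trans ?_
  rw [lintegral_add_right _ measurable_const, lintegral_const, measure_univ, mul_one]

lemma IsMixtureLaw.isProbabilityMeasure {θ : ℤ → ℂ} {g : Measure ℝ} [IsProbabilityMeasure g]
    {P : Measure (ℤ → ℂ)} (hP : IsMixtureLaw θ g P) : IsProbabilityMeasure P where
  measure_univ := by
    obtain ⟨Pp, hPp, hP⟩ := hP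
    have : ∀ φ, Pp φ univ = 1 := fun φ => (hPp φ).1.measure_univ
    simp [hP _ MeasurableSet.univ, this]

lemma dH_le_sqrt_of_le_add {X : Type*} [MeasurableSpace X] {P Q : Measure X}
    [IsFiniteMeasure P] [IsFiniteMeasure Q] {c : ℝ} (hc : 0 ≤ c)
    (hPQ : ∀ A, MeasurableSet A → P A ≤ Q A + ENNReal.ofReal c)
    (hQP : ∀ A, MeasurableSet A → Q A ≤ P A + ENNReal.ofReal c) :
    dH P Q ≤ √(2 * c) := by
  unfold dH
  refine Real.sqrt_le_sqrt ?_
  have real_le : ∀ {P Q : Measure X} [IsFiniteMeasure P] [IsFiniteMeasure Q] {A : Set X},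
      P A ≤ Q A + ENNReal.ofReal c → P.real A ≤ Q.real A + c := by
    intro P Q _ _ A h
    have := ENNReal.toReal_mono (by finiteness) h
    rwa [ENNReal.toReal_add (by finiteness) (by finiteness), ENNReal.toReal_ofReal hc] at this
  have hPac : P ≪ P + Q := Measure.absolutelyContinuous_of_le (Measure.le_add_right le_rfl)
  have hQac : Q ≪ P + Q := Measure.absolutelyContinuous_of_le (Measure.le_add_left le_rfl)
  set p := fun x => (P.rnDeriv (P + Q) x).toReal
  set q := fun x => (Q.rnDeriv (P + Q) x).toReal
  have hp : Integrable p (P + Q) := Measure.integrable_toReal_rnDeriv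
  have hq : Integrable q (P + Q) := Measure.integrable_toReal_rnDeriv
  have p0 : ∀ x, 0 ≤ p x := fun x => ENNReal.toReal_nonneg
  have q0 : ∀ x, 0 ≤ q x := fun x => ENNReal.toReal_nonneg
  have hpm : Measurable p := (Measure.measurable_rnDeriv _ _).ennreal_toReal
  have hqm : Measurable q := (Measure.measurable_rnDeriv _ _).ennreal_toReal
  have hpt : ∀ x, (√(p x) - √(q x)) ^ 2 ≤ |p x - q x| := by
    intro x
    have hu := Real.sqrt_nonneg (p x)
    have hv := Real.sqrt_nonneg (q x)
    have ep := Real.sq_sqrt (p0 x)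
    have eq := Real.sq_sqrt (q0 x)
    rcases le_total (q x) (p x) with h | h
    · have := Real.sqrt_le_sqrt h
      rw [abs_of_nonneg (sub_nonneg.2 h)]
      nlinarith
    · have := Real.sqrt_le_sqrt h
      rw [abs_of_nonpos (sub_nonpos.2 h)]
      nlinarith
  have hA : MeasurableSet {x | q x ≤ p x} := measurableSet_le hqm hpm
  have hpA : ∀ A, ∫ x in A, p x ∂(P + Q) = P.real A :=
    fun A => Measure.setIntegral_toReal_rnDeriv hPac A
  have hqA : ∀ A, ∫ x in A, q x ∂(P + Q) = Q.real A :=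
    fun A => Measure.setIntegral_toReal_rnDeriv hQac A
  calc ∫ x, (√(p x) - √(q x)) ^ 2 ∂(P + Q)
      ≤ ∫ x, |p x - q x| ∂(P + Q) :=
        integral_mono_of_nonneg (ae_of_all _ fun x => sq_nonneg _) (hp.sub hq).abs
          (ae_of_all _ hpt)
    _ = ∫ x in {x | q x ≤ p x}, |p x - q x| ∂(P + Q)
        + ∫ x in {x | q x ≤ p x}ᶜ, |p x - q x| ∂(P + Q) :=
        (integral_add_compl hA (hp.sub hq).abs).symm
    _ = ∫ x in {x | q x ≤ p x}, (p x - q x) ∂(P + Q)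
        + ∫ x in {x | q x ≤ p x}ᶜ, (q x - p x) ∂(P + Q) := by
        congr 1
        · exact setIntegral_congr_fun hA fun x hx => abs_of_nonneg (sub_nonneg.2 hx)
        · refine setIntegral_congr_fun hA.compl fun x hx => ?_
          have : p x < q x := not_le.1 hx
          change |p x - q x| = q x - p x
          rw [abs_of_neg (sub_neg.2 this), neg_sub]
    _ = (P.real {x | q x ≤ p x} - Q.real {x | q x ≤ p x})
        + (Q.real {x | q x ≤ p x}ᶜ - P.real {x | q x ≤ p x}ᶜ) := by
        rw [integral_sub hp.restrict hq.restrict, integral_sub hq.restrict hp.restrict,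
          hpA, hpA, hqA, hqA]
    _ ≤ 2 * c := by linarith [real_le (hPQ _ hA), real_le (hQP _ hA.compl)]

/-- d_H(P_{θ,g}, P_{θ̃,g}) ≤ 2^{1/4} ‖θ − θ̃‖^{1/2}. -/
theorem hellinger_mixture_le_sqrt_l2 (θ θt : ℤ → ℂ)
    (hθ : Summable (fun k : ℤ => ‖θ k‖ ^ 2)) (hθt : Summable (fun k : ℤ => ‖θt k‖ ^ 2))
    (g : Measure ℝ) (hg : IsProbOn01 g)
    (P Q : Measure (ℤ → ℂ)) (hP : IsMixtureLaw θ g P) (hQ : IsMixtureLaw θt g Q) :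
    dH P Q ≤ (2 : ℝ) ^ ((1 : ℝ) / 4) * Real.sqrt (l2norm (fun k => θ k - θt k)) := by
  have := hg.1
  have hs : Summable fun k => ‖θ k - θt k‖ ^ 2 := by
    refine Summable.of_nonneg_of_le (fun k => by positivity) (fun k => ?_)
      ((hθ.add hθt).mul_left 2)
    nlinarith [norm_sub_le (θ k) (θt k), norm_nonneg (θ k - θt k), sq_nonneg (‖θ k‖ - ‖θt k‖)]
  have hs' : Summable fun k => ‖θt k - θ k‖ ^ 2 := by simpa only [norm_sub_rev] using hs
  have := hP.isProbabilityMeasure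
  have := hQ.isProbabilityMeasure
  refine (dH_le_sqrt_of_le_add (Real.sqrt_nonneg _) (fun A hA => hP.le_add hQ hs hA)
    (fun A hA => ?_)).trans (le_of_eq ?_)
  · simpa only [norm_sub_rev] using hQ.le_add hP hs' hA
  · unfold l2norm
    have h4 : (2 : ℝ) ^ ((1 : ℝ) / 4) = √(√2) := by
      rw [Real.sqrt_eq_rpow, Real.sqrt_eq_rpow, ← Real.rpow_mul zero_le_two]
      norm_num
    rw [h4, ← Real.sqrt_mul (Real.sqrt_nonneg _), ← Real.sqrt_mul zero_le_two]
    congr 1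
    rw [show (2 : ℝ) * ∑' k, ‖θ k - θt k‖ ^ 2 = 2 ^ 2 * ((∑' k, ‖θ k - θt k‖ ^ 2) / 2) by ring,
      Real.sqrt_mul (by norm_num), Real.sqrt_sq zero_le_two]
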